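/- Monotone stability of DBDE solutions: let T ∈ (0,∞], u : [0,T] → [0,∞) integrable, and let (ρₙ) be a nonincreasing sequence of Lipschitz functions ℝ → [0,∞) converging pointwise to ρ̄, where ρ̄(y) = ρ(|y|) with ρ continuous, nondecreasing, ρ(0)=0, ρ(x) ≤ A(1+x), and ∫_{0⁺} dx/ρ(x) = +∞. Let (aₙ) be nonnegative reals decreasing to 0, and let fⁿ be the unique bounded solution of fⁿ_t = aₙ + ∫ₜᵀ u(s) ρₙ(k·fⁿ_s) ds (k ≥ 1 a fixed constant). Then fⁿ_t decreases to a limit f_t satisfying f_t = ∫ₜᵀ u(s) ρ(k·f_s) ds, and hence f_t = 0 for all t ∈ [0,T]. -/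

import Mathlib

open MeasureTheory Filter
open scoped ENNReal

/-- The interval `[0,T]` where `T ∈ (0,∞]` (i.e. `[0,∞)` if `T = ∞`). -/
def dbInterval (T : ℝ≥0∞) : Set ℝ := {t : ℝ | 0 ≤ t ∧ ENNReal.ofReal t ≤ T}

/-- The tail interval `[t,T]`. -/
def dbTail (T : ℝ≥0∞) (t : ℝ) : Set ℝ := {s : ℝ | t ≤ s ∧ ENNReal.ofReal s ≤ T}

/-- tail integrals as differences -/
lemma tail_sub {v : ℝ → ℝ} (hv : Integrable v) {a b : ℝ} (hab : a ≤ b) :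
    (∫ s in Set.Ioi a, v s) - ∫ s in Set.Ioi b, v s = ∫ s in Set.Ioc a b, v s := by
  have h := setIntegral_union (f := v) (μ := volume) (s := Set.Ioc a b) (t := Set.Ioi b)
    (Set.Ioc_disjoint_Ioi le_rfl) measurableSet_Ioi hv.integrableOn hv.integrableOn
  rw [Set.Ioc_union_Ioi_eq_Ioi hab] at h
  linarith

lemma tail_eq {v : ℝ → ℝ} (hv : Integrable v) (t : ℝ) :
    (∫ s in Set.Ioi t, v s) = (∫ s in Set.Ioi 0, v s) - ∫ s in (0:ℝ)..t, v s := by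
  rw [← intervalIntegral.integral_Ioi_sub_Ioi' hv.integrableOn hv.integrableOn]
  ring

lemma tail_cont {v : ℝ → ℝ} (hv : Integrable v) :
    Continuous (fun t => ∫ s in Set.Ioi t, v s) := by
  have : (fun t => ∫ s in Set.Ioi t, v s) =
      fun t => (∫ s in Set.Ioi 0, v s) - ∫ s in (0:ℝ)..t, v s := funext (tail_eq hv)
  rw [this]
  exact continuous_const.sub
    (intervalIntegral.continuous_primitive (fun a b => hv.intervalIntegrable) 0)

lemma tail_lim {v : ℝ → ℝ} (hv : Integrable v) :
    Tendsto (fun t => ∫ s in Set.Ioi t, v s) atTop (nhds 0) := by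
  have : (fun t => ∫ s in Set.Ioi t, v s) =
      fun t => (∫ s in Set.Ioi 0, v s) - ∫ s in (0:ℝ)..t, v s := funext (tail_eq hv)
  rw [this]
  have h := intervalIntegral_tendsto_integral_Ioi (f := v) (μ := volume) 0 hv.integrableOn tendsto_id
  simpa using h.const_sub (∫ s in Set.Ioi 0, v s)

lemma tail_anti {v : ℝ → ℝ} (hv : Integrable v) (h0 : ∀ s, 0 ≤ v s) :
    Antitone (fun t => ∫ s in Set.Ioi t, v s) := by
  intro a b hab
  have := tail_sub hv hab
  have h2 : 0 ≤ ∫ s in Set.Ioc a b, v s := integral_nonneg h0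
  simp only
  linarith

lemma osgood_zero (w v φ : ℝ → ℝ) (hw : Integrable w) (hw0 : ∀ s, 0 ≤ w s)
    (hv : Integrable v) (hv0 : ∀ s, 0 ≤ v s)
    (hφ : MonotoneOn φ (Set.Ici (0 : ℝ))) (hφ0 : ∀ x : ℝ, 0 ≤ x → 0 ≤ φ x)
    (hO : ∀ ε : ℝ, 0 < ε → ¬ IntegrableOn (fun x => (φ x)⁻¹) (Set.Ioc 0 ε))
    (hle : ∀ s, v s ≤ w s * φ (∫ r in Set.Ioi s, v r)) :
    ∀ t, (∫ s in Set.Ioi t, v s) = 0 := by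
  intro a
  by_contra hne
  set H : ℝ → ℝ := fun t => ∫ s in Set.Ioi t, v s with hH
  have hHnn : ∀ t, 0 ≤ H t := fun t => integral_nonneg hv0
  have hHa := tail_anti hv hv0
  have hHc := tail_cont hv
  have hc : 0 < H a := lt_of_le_of_ne (hHnn a) (Ne.symm hne)
  set c := H a with hcdef
  set r : ℕ → ℝ := fun n => c * (1 / 2) ^ n with hr
  have hrpos : ∀ n, 0 < r n := fun n => by simp only [hr]; positivity
  have hrs : ∀ n, r (n + 1) = r n / 2 := fun n => by simp only [hr, pow_succ]; ring
  have hrlim : Tendsto r atTop (nhds 0) := by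
    have := (tendsto_pow_atTop_nhds_zero_of_lt_one (r := (1 / 2 : ℝ)) (by norm_num)
      (by norm_num)).const_mul c
    simpa [hr] using this
  have hrle : ∀ n, r n ≤ c := fun n => by
    simp only [hr]
    have : (1 / 2 : ℝ) ^ n ≤ 1 := pow_le_one₀ (by norm_num) (by norm_num)
    nlinarith
  have hex : ∀ n, ∃ t, H t = r n := by
    intro n
    obtain ⟨b, hb⟩ := ((tail_lim hv).eventually (gt_mem_nhds (hrpos n))).exists
    exact mem_range_of_exists_le_of_exists_ge hHc ⟨b, hb.le⟩ ⟨a, hrle n⟩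
  choose t ht using hex
  have htm : ∀ n, t n ≤ t (n + 1) := by
    intro n
    by_contra hlt
    push Not at hlt
    have := hHa hlt.le
    have h1 : H (t n) ≤ H (t (n + 1)) := this
    rw [ht, ht, hrs] at h1
    linarith [hrpos n]
  set W : ℝ → ℝ := fun t => ∫ s in Set.Ioi t, w s with hW
  have hstep : ∀ n, r n / 2 ≤ φ (r n) * (W (t n) - W (t (n + 1))) := by
    intro n
    have h1 := tail_sub hv (htm n)
    have h2 := tail_sub hw (htm n)
    have e1 : H (t n) - H (t (n + 1)) = r n / 2 := by rw [ht, ht, hrs]; ring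
    rw [← e1]
    simp only [hH, hW]
    rw [h1, h2, ← integral_const_mul]
    apply setIntegral_mono_on hv.integrableOn (hw.integrableOn.const_mul _) measurableSet_Ioc
    intro s hs
    have h3 : H s ≤ r n := by rw [← ht n]; exact hHa hs.1.le
    have h4 : φ (H s) ≤ φ (r n) := hφ (hHnn s) (hrpos n).le h3
    calc v s ≤ w s * φ (H s) := hle s
      _ ≤ w s * φ (r n) := mul_le_mul_of_nonneg_left h4 (hw0 s)
      _ = _ := mul_comm _ _
  have hφpos : ∀ n, 0 < φ (r n) := by
    intro n
    rcases (hφ0 _ (hrpos n).le).lt_or_eq with h | h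
    · exact h
    · have := hstep n
      rw [← h, zero_mul] at this
      linarith [hrpos n]
  have hφp : ∀ x, 0 < x → 0 < φ x := by
    intro x hx
    obtain ⟨n, hn⟩ := (hrlim.eventually (gt_mem_nhds hx)).exists
    exact (hφpos n).trans_le (hφ (hrpos n).le hx.le hn.le)
  have hanti : AntitoneOn (fun x => (φ x)⁻¹) (Set.Ioi 0) := by
    intro x hx y hy hxy
    exact inv_anti₀ (hφp x hx) (hφ (Set.mem_Ici.2 (le_of_lt hx)) (Set.mem_Ici.2 (le_of_lt hy)) hxy)
  have hii : ∀ x y, 0 < x → 0 < y → IntervalIntegrable (fun x => (φ x)⁻¹) volume x y := by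
    intro x y hx hy
    apply AntitoneOn.intervalIntegrable
    apply hanti.mono
    intro z hz
    exact (lt_min hx hy).trans_le hz.1
  have hbound : ∀ n, ∫ x in r n..c, (φ x)⁻¹ ≤ 2 * (W (t 1) - W (t (n + 1))) := by
    intro n
    induction n with
    | zero => simp [hr]
    | succ n ih =>
      rw [← intervalIntegral.integral_add_adjacent_intervals (hii _ (r n) (hrpos _) (hrpos _))
        (hii _ _ (hrpos n) hc)]
      have h1 : ∫ x in r (n + 1)..r n, (φ x)⁻¹ ≤ ∫ x in r (n + 1)..r n, (φ (r (n + 1)))⁻¹ := by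
        apply intervalIntegral.integral_mono_on _ (hii _ _ (hrpos _) (hrpos _)) (by simp)
        · intro x hx
          exact hanti (hrpos (n + 1)) ((hrpos (n + 1)).trans_le hx.1) hx.1
        · rw [hrs]; linarith [hrpos n]
      rw [intervalIntegral.integral_const, smul_eq_mul] at h1
      have h2 := hstep (n + 1)
      have h3 : r n - r (n + 1) = r (n + 1) := by rw [hrs]; ring
      rw [h3, ← div_eq_mul_inv] at h1
      have h4 : r (n + 1) / φ (r (n + 1)) ≤ 2 * (W (t (n + 1)) - W (t (n + 1 + 1))) := by
        rw [div_le_iff₀ (hφpos _)]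
        linarith
      linarith
  refine hO c hc ?_
  refine integrableOn_Ioc_of_intervalIntegral_norm_bounded_left (a := r) (l := atTop)
    (I := 2 * W (t 1)) (fun n => ?_) hrlim (Eventually.of_forall fun n => ?_)
  · exact (intervalIntegrable_iff_integrableOn_Ioc_of_le (hrle n)).1 (hii _ _ (hrpos n) hc)
  · have hWn : 0 ≤ W (t (n + 1)) := integral_nonneg hw0
    have e : ∫ x in Set.Ioc (r n) c, ‖(φ x)⁻¹‖ = ∫ x in r n..c, (φ x)⁻¹ := by
      rw [intervalIntegral.integral_of_le (hrle n)]
      refine setIntegral_congr_fun measurableSet_Ioc fun x hx => ?_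
      have := hφp x ((hrpos n).trans hx.1)
      simp [abs_of_pos this]
    have := hbound n
    rw [e]
    linarith

/-- Comparison: a continuous function with one-sided linear bound on its decrease. -/
lemma compare_neg (w q : ℝ → ℝ) (b : ℝ) (hb : b ≤ 0) (hw : Integrable w) (hw0 : ∀ s, 0 ≤ w s)
    (hq : Integrable q) (hle : ∀ s, q s ≤ w s * |b + ∫ r in Set.Ioi s, q r|) :
    ∀ t, b + (∫ r in Set.Ioi t, q r) ≤ 0 := by
  set D : ℝ → ℝ := fun t => b + ∫ r in Set.Ioi t, q r with hD
  have hDc : Continuous D := continuous_const.add (tail_cont hq)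
  set v : ℝ → ℝ := fun s => w s * max (D s) 0 with hvdef
  have hv0 : ∀ s, 0 ≤ v s := fun s => mul_nonneg (hw0 s) (le_max_right _ _)
  have hDb : ∀ s, |max (D s) 0| ≤ |b| + ∫ r, |q r| := by
    intro s
    have h1 : |∫ r in Set.Ioi s, q r| ≤ ∫ r, |q r| :=
      (abs_integral_le_integral_abs).trans
        (setIntegral_le_integral hq.abs (Eventually.of_forall fun _ => abs_nonneg _))
    have h2 : D s ≤ |b| + ∫ r, |q r| := by
      have := le_abs_self b
      have := le_abs_self (∫ r in Set.Ioi s, q r)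
      simp only [hD]; linarith
    rw [abs_of_nonneg (le_max_right _ _)]
    refine max_le h2 ?_
    have : 0 ≤ ∫ r, |q r| := integral_nonneg fun _ => abs_nonneg _
    positivity
  have hv : Integrable v :=
    hw.mul_bdd (c := |b| + ∫ r, |q r|) (hDc.max continuous_const).aestronglyMeasurable
      (Eventually.of_forall hDb)
  have hDH : ∀ t, max (D t) 0 ≤ ∫ r in Set.Ioi t, v r := by
    intro t
    have hHn : ∀ t, 0 ≤ ∫ r in Set.Ioi t, v r := fun t => integral_nonneg hv0
    refine max_le ?_ (hHn t)
    by_contra hcon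
    push Not at hcon
    have hDt : 0 < D t := (hHn t).trans_lt hcon
    have hqv : ∀ s, 0 ≤ D s → q s ≤ v s := by
      intro s hs
      have := hle s
      simp only [hvdef, max_eq_left hs]
      rwa [← abs_of_nonneg hs]
    by_cases hne : ∃ s, t ≤ s ∧ D s ≤ 0
    · set S := {s | t ≤ s ∧ D s ≤ 0} with hS
      have hSc : IsClosed S := (isClosed_Ici (a := t)).inter (isClosed_le hDc continuous_const)
      have hSb : BddBelow S := ⟨t, fun s hs => hs.1⟩
      have hmem := hSc.csInf_mem hne hSb
      set z := sInf S with hz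
      have h1 := tail_sub hq hmem.1
      have h2 := tail_sub hv hmem.1
      have h3 : ∫ s in Set.Ioc t z, q s ≤ ∫ s in Set.Ioc t z, v s := by
        rw [integral_Ioc_eq_integral_Ioo, integral_Ioc_eq_integral_Ioo]
        apply setIntegral_mono_on hq.integrableOn hv.integrableOn measurableSet_Ioo
        intro s hs
        apply hqv
        by_contra hlt
        push Not at hlt
        exact absurd (csInf_le hSb (show s ∈ S from ⟨hs.1.le, hlt.le⟩)) (not_le.2 hs.2)
      have h4 := hHn z
      have h5 : D z ≤ 0 := hmem.2
      simp only [hD] at hcon h5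
      linarith
    · push Not at hne
      have h3 : ∫ s in Set.Ioi t, q s ≤ ∫ s in Set.Ioi t, v s := by
        apply setIntegral_mono_on hq.integrableOn hv.integrableOn measurableSet_Ioi
        intro s hs
        exact hqv s (hne s (le_of_lt hs)).le
      simp only [hD] at hcon
      linarith
  have hz := osgood_zero w v id hw hw0 hv hv0 monotoneOn_id (fun x hx => hx) (by
    intro ε hε hint
    have : IntervalIntegrable (fun x : ℝ => x⁻¹) volume 0 ε :=
      (intervalIntegrable_iff_integrableOn_Ioc_of_le hε.le).2 hint
    rw [intervalIntegrable_inv_iff] at this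
    rcases this with h | h
    · exact hε.ne h
    · exact h (by simp))
    (fun s => mul_le_mul_of_nonneg_left (hDH s) (hw0 s))
  intro t
  exact (le_max_left _ _).trans ((hDH t).trans_eq (hz t))

lemma dbTail_integral (T : ℝ≥0∞) (G : ℝ → ℝ) (t : ℝ) (ht : t ∈ dbInterval T) :
    ∫ s in dbTail T t, G s = ∫ s in Set.Ioi t, (dbInterval T).indicator G s := by
  have hm : MeasurableSet (dbInterval T) :=
    measurableSet_Ici.inter (measurableSet_le ENNReal.measurable_ofReal measurable_const)
  rw [← integral_Ici_eq_integral_Ioi, setIntegral_indicator hm]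
  congr 2
  ext s
  constructor
  · rintro ⟨h1, h2⟩
    exact ⟨h1, ht.1.trans h1, h2⟩
  · rintro ⟨h1, h2, h3⟩
    exact ⟨h1, h3⟩

theorem stmt_18 (T : ℝ≥0∞) (hT : 0 < T) (u : ℝ → ℝ) (ρ : ℝ → ℝ) (A k : ℝ)
    (hk : 1 ≤ k) (hA : 0 < A)
    (hu0 : ∀ t ∈ dbInterval T, 0 ≤ u t)
    (huInt : IntegrableOn u (dbInterval T))
    (hρc : ContinuousOn ρ (Set.Ici 0))
    (hρmono : MonotoneOn ρ (Set.Ici (0 : ℝ)))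
    (hρ0 : ρ 0 = 0) (hρnn : ∀ x : ℝ, 0 ≤ x → 0 ≤ ρ x)
    (hρgrowth : ∀ x : ℝ, 0 ≤ x → ρ x ≤ A * (1 + x))
    (hOsgood : ∀ ε : ℝ, 0 < ε → ¬ IntegrableOn (fun x => (ρ x)⁻¹) (Set.Ioc 0 ε))
    (ρseq : ℕ → ℝ → ℝ)
    (hρseqLip : ∀ n : ℕ, ∃ L : NNReal, LipschitzWith L (ρseq n))
    (hρseqanti : ∀ n : ℕ, ∀ y : ℝ, ρseq (n + 1) y ≤ ρseq n y)
    (hρseqge : ∀ n : ℕ, ∀ y : ℝ, ρ |y| ≤ ρseq n y)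
    (hρseqbdd : ∀ n : ℕ, ∀ y : ℝ, ρseq n y ≤ A * (1 + |y|))
    (hρseqlim : ∀ y : ℝ, Tendsto (fun n => ρseq n y) atTop (nhds (ρ |y|)))
    (aseq : ℕ → ℝ)
    (hann : ∀ n : ℕ, 0 ≤ aseq n) (hamono : Antitone aseq)
    (halim : Tendsto aseq atTop (nhds 0))
    (fseq : ℕ → ℝ → ℝ)
    (hfc : ∀ n : ℕ, ContinuousOn (fseq n) (dbInterval T))
    (hfb : ∀ n : ℕ, ∃ M : ℝ, ∀ t ∈ dbInterval T, |fseq n t| ≤ M)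
    (hfeq : ∀ n : ℕ, ∀ t ∈ dbInterval T,
      fseq n t = aseq n + ∫ s in dbTail T t, u s * ρseq n (k * fseq n s)) :
    ∃ flim : ℝ → ℝ,
      (∀ t ∈ dbInterval T, Antitone (fun n => fseq n t) ∧
        Tendsto (fun n => fseq n t) atTop (nhds (flim t))) ∧
      (∀ t ∈ dbInterval T, flim t = ∫ s in dbTail T t, u s * ρ (k * flim s)) ∧
      (∀ t ∈ dbInterval T, flim t = 0) := by
  have hm : MeasurableSet (dbInterval T) :=
    measurableSet_Ici.inter (measurableSet_le ENNReal.measurable_ofReal measurable_const)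
  have hk0 : 0 ≤ k := by linarith
  set w : ℝ → ℝ := (dbInterval T).indicator u with hwdef
  have hw : Integrable w := huInt.integrable_indicator hm
  have hw0 : ∀ s, 0 ≤ w s := fun s => Set.indicator_nonneg hu0 s
  set F : ℕ → ℝ → ℝ := fun n => (dbInterval T).indicator (fseq n) with hF
  have hFI : ∀ n, ∀ s ∈ dbInterval T, F n s = fseq n s := fun n s hs => by simp [hF, hs]
  have hFm : ∀ n, AEStronglyMeasurable (F n) volume := fun n =>
    (aestronglyMeasurable_indicator_iff hm).2 ((hfc n).aestronglyMeasurable hm)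
  have hFn : ∀ n s, 0 ≤ F n s := by
    intro n s
    refine Set.indicator_nonneg (fun t ht => ?_) s
    rw [hfeq n t ht, dbTail_integral T _ t ht]
    refine add_nonneg (hann n) (integral_nonneg fun s => ?_)
    exact Set.indicator_nonneg (fun x hx => mul_nonneg (hu0 x hx)
      ((hρnn _ (abs_nonneg _)).trans (hρseqge n _))) s
  have hFb : ∀ n, ∃ M, ∀ s, F n s ≤ M := by
    intro n
    obtain ⟨M, hM⟩ := hfb n
    refine ⟨max M 0, fun s => ?_⟩
    by_cases hs : s ∈ dbInterval T
    · rw [hFI n s hs]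
      exact (le_abs_self _).trans ((hM s hs).trans (le_max_left _ _))
    · simp [hF, hs]
  have hR0 : ∀ n y, 0 ≤ ρseq n y := fun n y => (hρnn _ (abs_nonneg _)).trans (hρseqge n y)
  set v : ℕ → ℝ → ℝ := fun n s => w s * ρseq n (k * F n s) with hvdef
  have hvm : ∀ n, AEStronglyMeasurable (v n) volume := by
    intro n
    obtain ⟨L, hL⟩ := hρseqLip n
    exact hw.aestronglyMeasurable.mul
      (hL.continuous.comp_aestronglyMeasurable ((hFm n).const_mul k))
  have hRb : ∀ n M s, F n s ≤ M → ρseq n (k * F n s) ≤ A * (1 + k * M) := by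
    intro n M s h
    refine (hρseqbdd n _).trans ?_
    rw [abs_of_nonneg (mul_nonneg hk0 (hFn n s))]
    gcongr
  have hv : ∀ n, Integrable (v n) := by
    intro n
    obtain ⟨M, hM⟩ := hFb n
    refine (hw.mul_const (A * (1 + k * M))).mono' (hvm n) (Eventually.of_forall fun s => ?_)
    rw [Real.norm_of_nonneg (mul_nonneg (hw0 s) (hR0 n _))]
    exact mul_le_mul_of_nonneg_left (hRb n M s (hM s)) (hw0 s)
  have hind : ∀ n, (dbInterval T).indicator (fun s => u s * ρseq n (k * fseq n s)) = v n := by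
    intro n
    ext s
    by_cases hs : s ∈ dbInterval T
    · simp [hvdef, hwdef, hF, hs]
    · simp [hvdef, hwdef, hs]
  have hfe : ∀ n, ∀ t ∈ dbInterval T, fseq n t = aseq n + ∫ s in Set.Ioi t, v n s := by
    intro n t ht
    rw [hfeq n t ht, dbTail_integral T _ t ht, hind]
  have hstep : ∀ n, ∀ t ∈ dbInterval T, fseq (n + 1) t ≤ fseq n t := by
    intro n
    obtain ⟨L, hL⟩ := hρseqLip n
    have hsub : ∀ s, (∫ r in Set.Ioi s, (v (n + 1) r - v n r)) =
        (∫ r in Set.Ioi s, v (n + 1) r) - ∫ r in Set.Ioi s, v n r := fun s =>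
      integral_sub (hv (n + 1)).integrableOn (hv n).integrableOn
    have key := compare_neg (fun s => w s * (L * k)) (fun s => v (n + 1) s - v n s)
      (aseq (n + 1) - aseq n) (by linarith [hamono (Nat.le_succ n)]) (hw.mul_const _)
      (fun s => mul_nonneg (hw0 s) (mul_nonneg L.2 hk0)) ((hv (n + 1)).sub (hv n)) (by
        intro s
        by_cases hs : s ∈ dbInterval T
        · have e : aseq (n + 1) - aseq n + (∫ r in Set.Ioi s, (v (n + 1) r - v n r)) =
              F (n + 1) s - F n s := by
            rw [hsub, hFI _ s hs, hFI _ s hs, hfe _ s hs, hfe _ s hs]; ring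
          rw [e, mul_assoc]
          simp only [hvdef]
          rw [← mul_sub]
          apply mul_le_mul_of_nonneg_left _ (hw0 s)
          have h1 := hL.dist_le_mul (k * F (n + 1) s) (k * F n s)
          rw [Real.dist_eq, Real.dist_eq, ← mul_sub, abs_mul, abs_of_nonneg hk0] at h1
          have h2 := hρseqanti n (k * F (n + 1) s)
          have h3 := le_abs_self (ρseq n (k * F (n + 1) s) - ρseq n (k * F n s))
          linarith
        · simp [hvdef, hwdef, hs])
    intro t ht
    have := key t
    rw [hsub] at this
    rw [hfe _ t ht, hfe _ t ht]
    linarith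
  have hanti : ∀ t ∈ dbInterval T, Antitone (fun n => fseq n t) := fun t ht =>
    antitone_nat_of_succ_le fun n => hstep n t ht
  have hlim : ∀ t ∈ dbInterval T,
      Tendsto (fun n => fseq n t) atTop (nhds (⨅ n, fseq n t)) := fun t ht =>
    tendsto_atTop_ciInf (hanti t ht) ⟨0, by
      rintro _ ⟨n, rfl⟩
      simpa [hFI n t ht] using hFn n t⟩
  set f : ℝ → ℝ := fun t => ⨅ n, fseq n t with hf
  have hfn : ∀ t ∈ dbInterval T, 0 ≤ f t := fun t ht =>
    ge_of_tendsto' (hlim t ht) fun n => by simpa [hFI n t ht] using hFn n t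
  have hRanti : ∀ y, Antitone (fun n => ρseq n y) := fun y =>
    antitone_nat_of_succ_le fun n => hρseqanti n y
  set vl : ℝ → ℝ := (dbInterval T).indicator (fun s => u s * ρ (k * f s)) with hvl
  have hvlim : ∀ s, Tendsto (fun n => v n s) atTop (nhds (vl s)) := by
    intro s
    by_cases hs : s ∈ dbInterval T
    · simp only [hvdef, hwdef, hvl, Set.indicator_of_mem hs]
      refine Tendsto.const_mul _ ?_
      simp only [hFI _ s hs]
      have hkl : Tendsto (fun n => k * fseq n s) atTop (nhds (k * f s)) :=
        (hlim s hs).const_mul k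
      have hkf : 0 ≤ k * f s := mul_nonneg hk0 (hfn s hs)
      have habs : ∀ n, |k * fseq n s| = k * fseq n s := fun n => by
        have := hFn n s
        rw [hFI n s hs] at this
        exact abs_of_nonneg (mul_nonneg hk0 this)
      rw [tendsto_order]
      constructor
      · intro a ha
        refine Eventually.of_forall fun n => ?_
        refine ha.trans_le (le_trans ?_ (hρseqge n _))
        refine hρmono (Set.mem_Ici.2 hkf) (Set.mem_Ici.2 (abs_nonneg _)) ?_
        rw [habs]
        exact mul_le_mul_of_nonneg_left ((hanti s hs).le_of_tendsto (hlim s hs) n) hk0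
      · intro a ha
        have h1 := hρseqlim (k * f s)
        rw [abs_of_nonneg hkf] at h1
        obtain ⟨m, hm⟩ := (h1.eventually (gt_mem_nhds ha)).exists
        obtain ⟨L, hL⟩ := hρseqLip m
        have h2 := (hL.continuous.tendsto _).comp hkl
        filter_upwards [h2.eventually (gt_mem_nhds hm), eventually_ge_atTop m] with n hn hmn
        exact (hRanti _ hmn).trans_lt hn
    · simp [hvdef, hwdef, hvl, hs]
  obtain ⟨M, hM⟩ := hFb 0
  have hdom : ∀ n s, ‖v n s‖ ≤ w s * (A * (1 + k * M)) := by
    intro n s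
    rw [Real.norm_of_nonneg (mul_nonneg (hw0 s) (hR0 n _))]
    by_cases hs : s ∈ dbInterval T
    · refine mul_le_mul_of_nonneg_left (hRb n M s (le_trans ?_ (hM s))) (hw0 s)
      rw [hFI _ s hs, hFI _ s hs]
      exact hanti s hs (Nat.zero_le n)
    · simp [hwdef, hs]
  have hfleq : ∀ t ∈ dbInterval T, f t = ∫ s in Set.Ioi t, vl s := by
    intro t ht
    have h1 : Tendsto (fun n => ∫ s in Set.Ioi t, v n s) atTop
        (nhds (∫ s in Set.Ioi t, vl s)) :=
      tendsto_integral_of_dominated_convergence (fun s => w s * (A * (1 + k * M)))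
        (fun n => (hvm n).restrict) (hw.mul_const _).integrableOn
        (fun n => Eventually.of_forall (hdom n)) (Eventually.of_forall hvlim)
    have h2 := halim.add h1
    rw [zero_add] at h2
    refine tendsto_nhds_unique (hlim t ht) (h2.congr fun n => ?_)
    exact (hfe n t ht).symm
  have hvlm : AEStronglyMeasurable vl volume :=
    aestronglyMeasurable_of_tendsto_ae atTop hvm (Eventually.of_forall hvlim)
  have hvli : Integrable vl := (hw.mul_const (A * (1 + k * M))).mono' hvlm
    (Eventually.of_forall fun s => le_of_tendsto' (hvlim s).norm fun n => hdom n s)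
  have hvl0 : ∀ s, 0 ≤ vl s := fun s => Set.indicator_nonneg (fun x hx =>
    mul_nonneg (hu0 x hx) (hρnn _ (mul_nonneg hk0 (hfn x hx)))) s
  have hzero := osgood_zero (fun s => k * w s) (fun s => k * vl s) ρ (hw.const_mul k)
    (fun s => mul_nonneg hk0 (hw0 s)) (hvli.const_mul k) (fun s => mul_nonneg hk0 (hvl0 s))
    hρmono hρnn hOsgood (by
      intro s
      rw [integral_const_mul]
      by_cases hs : s ∈ dbInterval T
      · rw [← hfleq s hs]
        simp [hvl, hwdef, hs, mul_assoc]
      · simp [hvl, hwdef, hs])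
  refine ⟨f, fun t ht => ⟨hanti t ht, hlim t ht⟩, fun t ht => ?_, fun t ht => ?_⟩
  · rw [dbTail_integral T _ t ht]
    exact hfleq t ht
  · have := hzero t
    rw [integral_const_mul, ← hfleq t ht] at this
    rcases mul_eq_zero.1 this with h | h
    · linarith
    · exact h
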